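/- The relations R_ac completed with the torsion relations c_i² = 1 make a presentation of the geometry group G(A,C) (isomorphic to Thompson's group V) in terms of the generators a_i = A_{1^{i−1}} and c_i = C_{1^{i−1}}: the canonical homomorphism from the group presented by generators {a_i, c_i : i ≥ 1} and the relations R_ac together with c_i² = 1 to G(A,C) is an isomorphism. -/

import Mathlib

/-- Coloured trees: finite rooted binary trees whose leaves are labelled by
positive integers. -/
inductive CTree : Type
  | leaf : ℕ+ → CTree
  | node : CTree → CTree → CTree

/-- Partial maps on coloured trees, as a monoid under reversed composition:
`(f * g) t = (f t).bind g`, i.e. `f * g` means "`f` then `g`". -/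
abbrev PMap : Type := CTree → Option CTree

instance : Monoid PMap where
  one := fun t => some t
  mul f g := fun t => (f t).bind g
  mul_assoc f g h := by
    funext t
    show ((f t).bind g).bind h = (f t).bind fun u => (g u).bind h
    cases f t <;> rfl
  one_mul f := rfl
  mul_one f := by
    funext t
    show (f t).bind some = f t
    cases f t <;> rfl

/-- The associativity operator `A`: maps `t₁·(t₂·t₃)` to `(t₁·t₂)·t₃`. -/
def opA : PMap
  | .node t₁ (.node t₂ t₃) => some (.node (.node t₁ t₂) t₃)
  | _ => none

/-- The inverse partial map of `A`: maps `(t₁·t₂)·t₃` to `t₁·(t₂·t₃)`. -/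
def opAi : PMap
  | .node (.node t₁ t₂) t₃ => some (.node t₁ (.node t₂ t₃))
  | _ => none

/-- The commutativity operator `C`: maps `t₁·t₂` to `t₂·t₁` (its own inverse
as a partial map). -/
def opC : PMap
  | .node t₁ t₂ => some (.node t₂ t₁)
  | _ => none

/-- The semi-commutativity operator `S`: maps `t₁·(t₂·t₃)` to `t₂·(t₁·t₃)`
(its own inverse as a partial map). -/
def opS : PMap
  | .node t₁ (.node t₂ t₃) => some (.node t₂ (.node t₁ t₃))
  | _ => none

/-- Addresses: finite words over `{0,1}`, with `false` = 0 (left) and `true` = 1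
(right). -/
abbrev Addr := List Bool

/-- `applyAt α f` is the shifted operator `∂_α f`, applying `f` to the
`α`-subtree of its argument. -/
def applyAt : Addr → PMap → PMap
  | [], f => f
  | false :: α, f => fun t => match t with
      | .node t₁ t₂ => (applyAt α f t₁).map (fun s => .node s t₂)
      | _ => none
  | true :: α, f => fun t => match t with
      | .node t₁ t₂ => (applyAt α f t₂).map (fun s => .node t₁ s)
      | _ => none

/-- Two partial maps are near-equal if they are both defined on at least one common
element, and they agree wherever both are defined. -/
def NearEq (f g : PMap) : Prop :=
  (∃ t, (f t).isSome ∧ (g t).isSome) ∧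
  ∀ t, (f t).isSome → (g t).isSome → f t = g t

/-- The generators of the geometry monoid `𝒢(A,C)`: the operators `A_α`, `C_α`
and their inverse partial maps (`C_α` is its own inverse). -/
def genAC : Set PMap :=
  {f | ∃ α : Addr, f = applyAt α opA ∨ f = applyAt α opAi ∨ f = applyAt α opC}

/-- The geometry monoid `𝒢(A,C)` of associativity and commutativity. -/
def GeoAC : Submonoid PMap := Submonoid.closure genAC

/-- The operator `a_{n+1} = A_{1^n}` (indices shifted by one: index `n : ℕ` stands
for subscript `n+1`). -/
def opa (n : ℕ) : PMap := applyAt (List.replicate n true) opA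

/-- The operator `c_{n+1} = C_{1^n}`. -/
def opc (n : ℕ) : PMap := applyAt (List.replicate n true) opC

theorem mema (n : ℕ) : opa n ∈ GeoAC :=
  Submonoid.subset_closure ⟨List.replicate n true, Or.inl rfl⟩

theorem memc (n : ℕ) : opc n ∈ GeoAC :=
  Submonoid.subset_closure ⟨List.replicate n true, Or.inr (Or.inr rfl)⟩

/-- Formal generators `a_{n+1}`, `c_{n+1}` (index `n : ℕ` stands for subscript `n+1`). -/
inductive Gen2 : Type
  | a : ℕ → Gen2
  | c : ℕ → Gen2

def fa (n : ℕ) : FreeGroup Gen2 := FreeGroup.of (Gen2.a n)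
def fc (n : ℕ) : FreeGroup Gen2 := FreeGroup.of (Gen2.c n)

/-- `fx b n` is `a` for `b = false` and `c` for `b = true`. -/
def fx : Bool → ℕ → FreeGroup Gen2
  | false, n => fa n
  | true, n => fc n

/-- The formal element `s_{n+1} = c_{n+1}·a_{n+1}⁻¹·c_{n+2}⁻¹`. -/
def fs (n : ℕ) : FreeGroup Gen2 := fc n * (fa n)⁻¹ * (fc (n + 1))⁻¹

/-- The relations `R_ac` together with the torsion relations `c_i² = 1`, as
relators (index `n` stands for subscript `i = n+1`, and `j = i+2+k`):
`a_i·x_{j-1} = x_j·a_i` and `s_i·x_j = x_j·s_i` for `j ≥ i+2` and `x ∈ {a,c}`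
(where `s_i = c_i·a_i⁻¹·c_{i+1}⁻¹`); `a_{i+1}·a_i·c_i^e·a_{i+1} = a_i²·c_i^e` for
`e = ±1`; `a_i·c_i·c_{i+1}·a_i = c_{i+1}·c_i`;
`c_{i+1}·c_i·a_i⁻¹·c_{i+1} = c_i·a_i⁻¹·c_i·a_i⁻¹`; and `c_i² = 1`. -/
def relsac : Set (FreeGroup Gen2) :=
  {x | (∃ (b : Bool) (n k : ℕ),
      x = fa n * fx b (n + 1 + k) * (fx b (n + 2 + k) * fa n)⁻¹) ∨
    (∃ (b : Bool) (n k : ℕ),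
      x = fs n * fx b (n + 2 + k) * (fx b (n + 2 + k) * fs n)⁻¹) ∨
    (∃ n : ℕ, x = fa (n + 1) * fa n * fc n * fa (n + 1) * (fa n * fa n * fc n)⁻¹) ∨
    (∃ n : ℕ,
      x = fa (n + 1) * fa n * (fc n)⁻¹ * fa (n + 1) * (fa n * fa n * (fc n)⁻¹)⁻¹) ∨
    (∃ n : ℕ, x = fa n * fc n * fc (n + 1) * fa n * (fc (n + 1) * fc n)⁻¹) ∨
    (∃ n : ℕ, x = fc (n + 1) * fc n * (fa n)⁻¹ * fc (n + 1) *
        (fc n * (fa n)⁻¹ * fc n * (fa n)⁻¹)⁻¹) ∨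
    (∃ n : ℕ, x = fc n * fc n)}

section GroupPart
variable {P : Type*} [Group P]

/-- The element `s_n`, using the torsion relations. -/
def sEl (a c : ℕ → P) (n : ℕ) : P := c n * (a n)⁻¹ * c (n + 1)

/-- The relations, in an arbitrary group. -/
structure ACRels (a c : ℕ → P) : Prop where
  sha : ∀ n k, a n * a (n + 1 + k) = a (n + 2 + k) * a n
  shc : ∀ n k, a n * c (n + 1 + k) = c (n + 2 + k) * a n
  sca : ∀ n k, sEl a c n * a (n + 2 + k) = a (n + 2 + k) * sEl a c n
  scc : ∀ n k, sEl a c n * c (n + 2 + k) = c (n + 2 + k) * sEl a c n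
  r3 : ∀ n, a (n + 1) * a n * c n * a (n + 1) = a n * a n * c n
  r4 : ∀ n, a n * c n * c (n + 1) * a n = c (n + 1) * c n
  r5 : ∀ n, c (n + 1) * c n * (a n)⁻¹ * c (n + 1) = c n * (a n)⁻¹ * c n * (a n)⁻¹
  cc : ∀ n, c n * c n = 1

theorem core_ss {a c d : P} (hc : c * c = 1) (hd : d * d = 1)
    (h4 : a * c * d * a = d * c) : c * a⁻¹ * d * (c * a⁻¹ * d) = 1 := by
  calc c * a⁻¹ * d * (c * a⁻¹ * d) = c * a⁻¹ * (d * c) * a⁻¹ * d := by simp only [mul_assoc]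
    _ = (c * c) * (d * d) := by rw [← h4]; simp [mul_assoc]
    _ = 1 := by rw [hc, hd, one_mul]

theorem core_sinv {a c d : P} (hc : c * c = 1) (hd : d * d = 1)
    (h4 : a * c * d * a = d * c) : c * a⁻¹ * d = d * a * c := by
  have h := eq_inv_of_mul_eq_one_left (core_ss hc hd h4)
  rw [h]
  simp [mul_assoc, inv_eq_of_mul_eq_one_left hc, inv_eq_of_mul_eq_one_left hd]

theorem core_H1 {a b c d e : P} (hc : c * c = 1) (hd : d * d = 1)
    (h3 : b * a * c * b = a * a * c)
    (h4 : a * c * d * a = d * c) (h4' : b * d * e * b = e * d) (h1 : a * d = e * a) :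
    a * (c * a⁻¹ * d) = (d * b⁻¹ * e) * (c * a⁻¹ * d) * b := by
  have h4i : b⁻¹ * (e * d) * b⁻¹ = d * e := by rw [← h4']; simp [mul_assoc]
  have h3i : a * c * b = b⁻¹ * (a * a * c) := by rw [← h3]; simp [mul_assoc]
  rw [core_sinv hc hd h4]
  symm
  calc d * b⁻¹ * e * (d * a * c) * b = d * b⁻¹ * e * d * (a * c * b) := by simp only [mul_assoc]
    _ = d * (b⁻¹ * (e * d) * b⁻¹) * a * a * c := by rw [h3i]; simp only [mul_assoc]
    _ = (d * d) * (e * a) * a * c := by rw [h4i]; simp only [mul_assoc]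
    _ = a * (d * a * c) := by rw [hd, ← h1]; simp only [mul_assoc, one_mul]

theorem core_braid_c {a c d : P} (hd : d * d = 1)
    (h5 : d * c * a⁻¹ * d = c * a⁻¹ * c * a⁻¹) :
    (c * a⁻¹ * d) * d * (c * a⁻¹ * d) = d * (c * a⁻¹ * d) * d := by
  calc (c * a⁻¹ * d) * d * (c * a⁻¹ * d) = c * a⁻¹ * (d * d) * c * a⁻¹ * d := by
        simp only [mul_assoc]
    _ = (c * a⁻¹ * c * a⁻¹) * d := by rw [hd]; simp only [mul_assoc, one_mul]
    _ = d * (c * a⁻¹ * d) * d := by rw [← h5]; simp only [mul_assoc]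

theorem core_z {a c d : P} (hc : c * c = 1) (hd : d * d = 1)
    (h4 : a * c * d * a = d * c)
    (h5 : d * c * a⁻¹ * d = c * a⁻¹ * c * a⁻¹) :
    c * a⁻¹ * d = a * (c * d * c) * a⁻¹ := by
  have h3 : (c * a⁻¹) * (c * a⁻¹) * (c * a⁻¹) = 1 := by
    calc (c * a⁻¹) * (c * a⁻¹) * (c * a⁻¹) = (c * a⁻¹) * (c * a⁻¹ * c * a⁻¹) := by
          simp only [mul_assoc]
      _ = c * a⁻¹ * d * (c * a⁻¹ * d) := by rw [← h5]; simp only [mul_assoc]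
      _ = 1 := core_ss hc hd h4
  have hx : c * a⁻¹ = a * c * (a * c) := by
    have := eq_inv_of_mul_eq_one_right h3
    rw [this]; simp [mul_assoc, inv_eq_of_mul_eq_one_left hc]
  calc c * a⁻¹ * d = a * c * (a * c) * d := by rw [hx]
    _ = a * c * (a * c * d * a) * a⁻¹ := by simp [mul_assoc]
    _ = a * (c * d * c) * a⁻¹ := by rw [h4]; simp only [mul_assoc]

theorem core_nat {a c d e : P} (hc : c * c = 1) (hd : d * d = 1)
    (h4 : a * c * d * a = d * c)
    (h5 : d * c * a⁻¹ * d = c * a⁻¹ * c * a⁻¹) (h1 : a * d = e * a)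
    (h2 : c * a⁻¹ * d * e = e * (c * a⁻¹ * d)) :
    (c * a⁻¹ * d) * (c * d * c) = (d * e * d) * (c * a⁻¹ * d) := by
  have hz := core_z hc hd h4 h5
  have hcom : d * (c * d * c) = (c * d * c) * d := by
    rw [hz] at h2
    have he : e = a * d * a⁻¹ := by rw [h1]; simp
    rw [he] at h2
    have : a * ((c * d * c) * d) * a⁻¹ = a * (d * (c * d * c)) * a⁻¹ := by
      simpa [mul_assoc] using h2
    exact (mul_left_cancel (mul_right_cancel this)).symm
  have h4i : d * c * a⁻¹ = a * c * d := by rw [← h4]; simp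
  symm
  calc d * e * d * (c * a⁻¹ * d) = d * e * (d * c * a⁻¹) * d := by simp only [mul_assoc]
    _ = d * (e * a) * c * d * d := by rw [h4i]; simp only [mul_assoc]
    _ = d * (a * d) * c := by rw [← h1]; simp only [mul_assoc, hd, mul_one]
    _ = (d * a * c) * (c * d * c) := by
        simp only [mul_assoc]; rw [← mul_assoc c c, hc, one_mul]
    _ = _ := by rw [core_sinv hc hd h4]

theorem core_braid_s {a b s s' z z' : P} (h1 : a * s = s' * s * b) (hss : s * s = 1)
    (hss' : s' * s' = 1) (hz : s = a * z * a⁻¹) (hz' : s' = b * z' * b⁻¹)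
    (hn : s * z = z' * s) : s * s' * s = s' * s * s' := by
  have hi : s * a⁻¹ = b⁻¹ * s * s' := by
    have := congrArg (fun x => x⁻¹) h1
    simpa [mul_assoc, inv_eq_of_mul_eq_one_left hss, inv_eq_of_mul_eq_one_left hss'] using this
  have hi2 : s * s' = b * (s * a⁻¹) := by rw [hi]; simp [mul_assoc]
  calc s * s' * s = b * (s * a⁻¹) * (a * z * a⁻¹) := by rw [hi2, ← hz]
    _ = b * (s * z) * a⁻¹ := by simp [mul_assoc]
    _ = b * z' * (s * a⁻¹) := by rw [hn]; simp only [mul_assoc]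
    _ = (b * z' * b⁻¹) * s * s' := by rw [hi]; simp only [mul_assoc]
    _ = s' * s * s' := by rw [← hz']

namespace ACRels
variable {a c : ℕ → P}

theorem ss (R : ACRels a c) (n : ℕ) : sEl a c n * sEl a c n = 1 := core_ss (R.cc n) (R.cc _) (R.r4 n)

theorem H1 (R : ACRels a c) (n : ℕ) : a n * sEl a c n = sEl a c (n + 1) * sEl a c n * a (n + 1) :=
  core_H1 (R.cc n) (R.cc _) (R.r3 n) (R.r4 n) (R.r4 (n + 1)) (R.shc n 0)

theorem H2 (R : ACRels a c) (n : ℕ) : a n * c n = c (n + 1) * sEl a c n := by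
  unfold sEl
  rw [core_sinv (R.cc n) (R.cc _) (R.r4 n), mul_assoc, ← mul_assoc, R.cc, one_mul]

theorem braid_c (R : ACRels a c) (n : ℕ) :
    sEl a c n * c (n + 1) * sEl a c n = c (n + 1) * sEl a c n * c (n + 1) :=
  core_braid_c (R.cc _) (R.r5 n)

theorem braid_s (R : ACRels a c) (n : ℕ) : sEl a c n * sEl a c (n + 1) * sEl a c n =
    sEl a c (n + 1) * sEl a c n * sEl a c (n + 1) :=
  core_braid_s (R.H1 n) (R.ss n) (R.ss _)
    (core_z (R.cc n) (R.cc _) (R.r4 n) (R.r5 n))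
    (core_z (R.cc (n + 1)) (R.cc _) (R.r4 (n + 1)) (R.r5 (n + 1)))
    (core_nat (R.cc n) (R.cc _) (R.r4 n) (R.r5 n) (R.shc n 0) (R.scc n 0))

theorem shs (R : ACRels a c) (n k : ℕ) : a n * sEl a c (n + 1 + k) = sEl a c (n + 2 + k) * a n := by
  have h1 := R.shc n k
  have h2 := R.sha n k
  have h3 := R.shc n (k + 1)
  have h2' : a n * (a (n + 1 + k))⁻¹ = (a (n + 2 + k))⁻¹ * a n := by
    rw [mul_inv_eq_iff_eq_mul, mul_assoc, h2]; simp
  unfold sEl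
  rw [show n + 1 + k + 1 = n + 1 + (k + 1) by omega,
    show n + 2 + k + 1 = n + 2 + (k + 1) by omega]
  rw [← mul_assoc, ← mul_assoc, h1, mul_assoc (c _), h2', ← mul_assoc, mul_assoc, h3]
  simp only [mul_assoc]

theorem scs (R : ACRels a c) (n k : ℕ) : Commute (sEl a c n) (sEl a c (n + 2 + k)) := by
  have h1 : Commute (sEl a c n) (c (n + 2 + k)) := R.scc n k
  have h2 : Commute (sEl a c n) (a (n + 2 + k)) := R.sca n k
  have h3 : Commute (sEl a c n) (c (n + 2 + k + 1)) := R.scc n (k + 1)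
  exact (h1.mul_right h2.inv_right).mul_right h3

end ACRels
end GroupPart

/-- The left-to-right list of labels of a tree. -/
def CTree.leaves : CTree → List ℕ+
  | .leaf x => [x]
  | .node u v => u.leaves ++ v.leaves

/-- The number of leaves. -/
def CTree.size (t : CTree) : ℕ := t.leaves.length

def lvs : List CTree → List ℕ+
  | [] => []
  | p :: ps => p.leaves ++ lvs ps

theorem length_leaves_ne_zero (t : CTree) : t.leaves.length ≠ 0 := by
  induction t with
  | leaf => simp [CTree.leaves]
  | node u v ihu ihv => simp only [CTree.leaves, List.length_append]; omega

theorem lvs_append (p q : List CTree) : lvs (p ++ q) = lvs p ++ lvs q := by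
  induction p with
  | nil => rfl
  | cons p ps ih => simp [lvs, ih]

theorem nodup_swap {p u v r : List ℕ+} (h : (p ++ (u ++ (v ++ r))).Nodup) :
    (p ++ (v ++ (u ++ r))).Nodup := by
  refine (List.Perm.nodup_iff (List.Perm.append_left p ?_)).1 h
  rw [← List.append_assoc, ← List.append_assoc]
  exact List.Perm.append_right r List.perm_append_comm

section TreePart
variable {P : Type*} [Group P]

/-- `flat n t` turns `t·r` at depth `n` into a comb over `r`. -/
def flat (a : ℕ → P) : ℕ → CTree → P
  | _, .leaf _ => 1
  | n, .node u v => (a n)⁻¹ * flat a n u * flat a (n + u.size) v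

/-- `comb n t` turns `t` at depth `n` into the right comb. -/
def comb (a : ℕ → P) : ℕ → CTree → P
  | _, .leaf _ => 1
  | n, .node u v => flat a n u * comb a (n + u.size) v

/-- Right comb of trees. -/
def spine : List CTree → CTree → CTree
  | [], r => r
  | p :: ps, r => .node p (spine ps r)

def flats (a : ℕ → P) : ℕ → List CTree → P
  | _, [] => 1
  | n, p :: ps => flat a n p * flats a (n + p.size) ps

theorem size_node (u v : CTree) : (CTree.node u v).size = u.size + v.size := by
  simp [CTree.size, CTree.leaves]

theorem leaves_spine (p : List CTree) (r : CTree) : (spine p r).leaves = lvs p ++ r.leaves := by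
  induction p with
  | nil => rfl
  | cons p ps ih => simp [spine, CTree.leaves, lvs, ih]

theorem spine_append (p q : List CTree) (r : CTree) :
    spine (p ++ q) r = spine p (spine q r) := by
  induction p with
  | nil => rfl
  | cons p ps ih => simp [spine, ih]

theorem comb_spine (a : ℕ → P) (n : ℕ) (p : List CTree) (r : CTree) :
    comb a n (spine p r) = flats a n p * comb a (n + (lvs p).length) r := by
  induction p generalizing n with
  | nil => simp [spine, flats, lvs]
  | cons p ps ih => simp [spine, flats, lvs, comb, ih, CTree.size, mul_assoc, add_assoc]

theorem flat_shift {a x : ℕ → P} (hx : ∀ n k, a n * x (n + 1 + k) = x (n + 2 + k) * a n)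
    (t : CTree) : ∀ n k, flat a n t * x (n + k + t.size) = x (n + k + 1) * flat a n t := by
  induction t with
  | leaf y => intro n k; simp [flat, CTree.size, CTree.leaves]
  | node u v ihu ihv =>
    intro n k
    have h1 := ihv (n + u.size) k
    have h2 := ihu n (k + 1)
    have h3 : (a n)⁻¹ * x (n + 2 + k) = x (n + 1 + k) * (a n)⁻¹ := by
      rw [inv_mul_eq_iff_eq_mul, ← mul_assoc, hx]; simp
    rw [size_node, show n + k + (u.size + v.size) = n + u.size + k + v.size by omega]
    simp only [flat]
    rw [mul_assoc, h1, show n + u.size + k + 1 = n + (k + 1) + u.size by omega, ← mul_assoc,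
      mul_assoc _ (flat a n u), h2, ← mul_assoc, show n + (k + 1) + 1 = n + 2 + k by omega, h3,
      show n + 1 + k = n + k + 1 by omega]
    simp only [mul_assoc]

theorem flats_shift {a x : ℕ → P} (hx : ∀ n k, a n * x (n + 1 + k) = x (n + 2 + k) * a n)
    (p : List CTree) : ∀ n k, flats a n p * x (n + k + (lvs p).length) =
      x (n + k + p.length) * flats a n p := by
  induction p with
  | nil => intro n k; simp [flats, lvs]
  | cons t ps ih =>
    intro n k
    have h1 := ih (n + t.size) k
    have h2 := flat_shift hx t n (k + ps.length)
    simp only [flats, lvs, List.length_append, List.length_cons]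
    rw [show n + k + (t.leaves.length + (lvs ps).length) = n + t.size + k + (lvs ps).length by
      simp only [CTree.size]; omega, mul_assoc, h1, ← mul_assoc,
      show n + t.size + k + ps.length = n + (k + ps.length) + t.size by omega, h2, mul_assoc]
    rw [show n + (k + ps.length) + 1 = n + k + (ps.length + 1) by omega]

theorem flats_shift0 {a x : ℕ → P} (hx : ∀ n k, a n * x (n + 1 + k) = x (n + 2 + k) * a n)
    (p : List CTree) : x p.length * flats a 0 p = flats a 0 p * x (lvs p).length := by
  simpa using (flats_shift hx p 0 0).symm

/-- The transposition at position `k` of a comb, with `m` further entries on the right. -/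
def tau (a c : ℕ → P) (k m : ℕ) : P := if m = 0 then c k else sEl a c k

def ins (a c : ℕ → P) : ℕ → ℕ+ → List ℕ+ → P
  | _, _, [] => 1
  | k, x, y :: l => if x ≤ y then 1 else tau a c k l.length * ins a c (k + 1) x l

def sortEl (a c : ℕ → P) : ℕ → List ℕ+ → P
  | _, [] => 1
  | k, x :: l => sortEl a c (k + 1) l * ins a c k x (l.insertionSort (· ≤ ·))

namespace ACRels
variable {a c : ℕ → P}

theorem flat_comm (R : ACRels a c) (k : ℕ) (t : CTree) :
    ∀ n, k + 2 ≤ n → Commute (sEl a c k) (flat a n t) := by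
  induction t with
  | leaf y => intro n _; exact Commute.one_right _
  | node u v ihu ihv =>
    intro n hn
    have h : Commute (sEl a c k) (a n) := by
      obtain ⟨m, rfl⟩ := Nat.exists_eq_add_of_le hn
      exact R.sca k m
    exact (h.inv_right.mul_right (ihu n hn)).mul_right (ihv _ (by omega))

theorem comb_comm (R : ACRels a c) (k : ℕ) (t : CTree) :
    ∀ n, k + 2 ≤ n → Commute (sEl a c k) (comb a n t) := by
  induction t with
  | leaf y => intro n _; exact Commute.one_right _
  | node u v ihu ihv =>
    intro n hn
    exact (R.flat_comm k u n hn).mul_right (ihv _ (by omega))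

theorem tau_comm (R : ACRels a c) (k n m : ℕ) (hn : k + 2 ≤ n) : Commute (sEl a c k) (tau a c n m) := by
  obtain ⟨j, rfl⟩ := Nat.exists_eq_add_of_le hn
  unfold tau
  split_ifs
  · exact R.scc k j
  · exact R.scs k j

theorem ins_comm (R : ACRels a c) (k : ℕ) (x : ℕ+) (l : List ℕ+) :
    ∀ n, k + 2 ≤ n → Commute (sEl a c k) (ins a c n x l) := by
  induction l with
  | nil => intro n _; exact Commute.one_right _
  | cons y l ih =>
    intro n hn
    unfold ins
    split_ifs
    · exact Commute.one_right _
    · exact (R.tau_comm k n _ hn).mul_right (ih _ (by omega))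

theorem sortEl_comm (R : ACRels a c) (k : ℕ) (l : List ℕ+) :
    ∀ n, k + 2 ≤ n → Commute (sEl a c k) (sortEl a c n l) := by
  induction l with
  | nil => intro n _; exact Commute.one_right _
  | cons y l ih =>
    intro n hn
    exact (ih _ (by omega)).mul_right (R.ins_comm k _ _ _ hn)

theorem tautau (R : ACRels a c) (k m : ℕ) : tau a c k m * tau a c k m = 1 := by
  unfold tau
  split_ifs
  · exact R.cc k
  · exact R.ss k

theorem braid (R : ACRels a c) (k m : ℕ) : tau a c (k + 1) m * sEl a c k * tau a c (k + 1) m =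
    sEl a c k * tau a c (k + 1) m * sEl a c k := by
  unfold tau
  split_ifs
  · exact (R.braid_c k).symm
  · exact (R.braid_s k).symm

theorem pair_lt (R : ACRels a c) {x y : ℕ+} (hxy : x < y) (l : List ℕ+) : ∀ k,
    ins a c (k + 1) y l * ins a c k x (l.orderedInsert (· ≤ ·) y) =
      tau a c k l.length *
        (ins a c (k + 1) x l * ins a c k y (l.orderedInsert (· ≤ ·) x)) := by
  induction l with
  | nil =>
    intro k
    simp [ins, hxy.le, hxy.not_ge, R.tautau]
  | cons z l ih =>
    intro k
    by_cases h1 : y ≤ z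
    · have h2 : x ≤ z := hxy.le.trans h1
      simp [ins, h1, h2, hxy.le, hxy.not_ge, R.tautau]
    · by_cases h2 : x ≤ z
      · simp only [ins, List.orderedInsert, h1, h2, if_true, if_false, hxy.not_ge, mul_one,
          one_mul, List.length_cons]
        rw [← mul_assoc (tau a c k _) (tau a c k _), R.tautau, one_mul]
      · have hs : ∀ m, tau a c k (m + 1) = sEl a c k := fun m => by simp [tau]
        simp only [ins, List.orderedInsert, h1, h2, if_false, List.length_cons,
          List.orderedInsert_length, hs]
        have e1 := (R.ins_comm k y l (k + 1 + 1) (by omega)).eq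
        have e2 := (R.ins_comm k x l (k + 1 + 1) (by omega)).eq
        have e3 := ih (k + 1)
        have e4 := R.braid k l.length
        calc _ = tau a c (k + 1) l.length * (ins a c (k + 1 + 1) y l * sEl a c k) *
              ins a c (k + 1) x (List.orderedInsert (· ≤ ·) y l) := by simp only [mul_assoc]
          _ = tau a c (k + 1) l.length * sEl a c k * (ins a c (k + 1 + 1) y l *
              ins a c (k + 1) x (List.orderedInsert (· ≤ ·) y l)) := by
                rw [← e1]; simp only [mul_assoc]
          _ = (tau a c (k + 1) l.length * sEl a c k * tau a c (k + 1) l.length) *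
              (ins a c (k + 1 + 1) x l *
                ins a c (k + 1) y (List.orderedInsert (· ≤ ·) x l)) := by
                rw [e3]; simp only [mul_assoc]
          _ = sEl a c k * tau a c (k + 1) l.length * (sEl a c k * ins a c (k + 1 + 1) x l) *
                ins a c (k + 1) y (List.orderedInsert (· ≤ ·) x l) := by
                rw [e4]; simp only [mul_assoc]
          _ = _ := by rw [e2]; simp only [mul_assoc]

theorem pair_ne (R : ACRels a c) {x y : ℕ+} (hxy : x ≠ y) (l : List ℕ+) (k : ℕ) :
    ins a c (k + 1) y l * ins a c k x (l.orderedInsert (· ≤ ·) y) =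
      tau a c k l.length *
        (ins a c (k + 1) x l * ins a c k y (l.orderedInsert (· ≤ ·) x)) := by
  rcases lt_or_gt_of_ne hxy with h | h
  · exact R.pair_lt h l k
  · rw [R.pair_lt h l k, ← mul_assoc, R.tautau, one_mul]

theorem sortEl_swap (R : ACRels a c) {x y : ℕ+} (hxy : x ≠ y) (p l : List ℕ+) : ∀ k,
    sortEl a c k (p ++ x :: y :: l) =
      tau a c (k + p.length) l.length * sortEl a c k (p ++ y :: x :: l) := by
  induction p with
  | nil =>
    intro k
    have h := R.pair_ne hxy (l.insertionSort (· ≤ ·)) k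
    rw [List.length_insertionSort] at h
    have hc : Commute (tau a c k l.length) (sortEl a c (k + 1 + 1) l) := by
      cases l with
      | nil => exact Commute.one_right _
      | cons z l =>
        have : tau a c k (z :: l).length = sEl a c k := by simp [tau]
        rw [this]
        exact R.sortEl_comm k _ _ (by omega)
    simp only [List.nil_append, sortEl, List.insertionSort_cons, List.length_nil, add_zero]
    rw [mul_assoc, h, ← mul_assoc, ← hc.eq]
    simp only [mul_assoc]
  | cons z p ih =>
    intro k
    have hs : (p ++ x :: y :: l).insertionSort (· ≤ ·) =
        (p ++ y :: x :: l).insertionSort (· ≤ ·) := by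
      apply List.Perm.eq_of_pairwise' (r := (· ≤ ·))
      · exact List.pairwise_insertionSort _ _
      · exact List.pairwise_insertionSort _ _
      · refine (List.perm_insertionSort _ _).trans (List.Perm.trans ?_
          (List.perm_insertionSort _ _).symm)
        exact List.Perm.append_left p (List.Perm.swap _ _ _)
    simp only [List.cons_append, sortEl, List.length_cons]
    rw [ih (k + 1), hs, show k + 1 + p.length = k + (p.length + 1) by omega, mul_assoc]

end ACRels

/-- The invariant: the element taking `t` to the sorted right comb. -/
def Phi (a c : ℕ → P) (t : CTree) : P := comb a 0 t * sortEl a c 0 t.leaves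

namespace ACRels
variable {a c : ℕ → P}

theorem phi_a (R : ACRels a c) (p : List CTree) (u v r : CTree) :
    Phi a c (spine p (.node u (.node v r))) =
      a p.length * Phi a c (spine p (.node (.node u v) r)) := by
  unfold Phi
  rw [comb_spine, comb_spine, ← mul_assoc, ← mul_assoc, flats_shift0 R.sha]
  simp only [leaves_spine, CTree.leaves, comb, flat, size_node]
  simp [mul_assoc, add_assoc]

/-- `S`-claim. -/
def SClaim (a c : ℕ → P) (u v : CTree) : Prop := ∀ (p : List CTree) (r : CTree),
  (lvs p ++ (u.leaves ++ (v.leaves ++ r.leaves))).Nodup →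
    Phi a c (spine p (.node u (.node v r))) =
      sEl a c p.length * Phi a c (spine p (.node v (.node u r)))

theorem sclaim_symm (R : ACRels a c) {u v : CTree} (h : SClaim a c u v) : SClaim a c v u := by
  intro p r hn
  rw [h p r (nodup_swap hn), ← mul_assoc, R.ss, one_mul]

theorem sclaim_leaf (R : ACRels a c) (x y : ℕ+) : SClaim a c (.leaf x) (.leaf y) := by
  intro p r hn
  have hxy : x ≠ y := by
    rintro rfl
    rw [List.nodup_append] at hn
    simp [CTree.leaves] at hn
  have hl := length_leaves_ne_zero r
  have hsw := R.sortEl_swap hxy (lvs p) r.leaves 0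
  rw [tau, if_neg hl, zero_add] at hsw
  unfold Phi
  simp only [comb_spine, leaves_spine, CTree.leaves, comb, flat, List.cons_append,
    List.nil_append, one_mul, CTree.size, List.length_cons, List.length_nil]
  rw [← mul_assoc (sEl a c _), ← mul_assoc (sEl a c _), flats_shift0 R.shs, hsw, mul_assoc _ (sEl a c _),
    (R.comb_comm _ r _ (by omega)).eq]
  simp only [mul_assoc]

theorem sclaim_step (R : ACRels a c) {u1 u2 v : CTree} (h1 : SClaim a c u1 v) (h2 : SClaim a c u2 v) :
    SClaim a c (.node u1 u2) v := by
  intro p r hn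
  simp only [CTree.leaves, List.append_assoc] at hn
  have e1 := R.phi_a p u1 u2 (.node v r)
  have e2 := h2 (p ++ [u1]) r (by simpa [lvs_append, lvs] using hn)
  have hn' : (lvs p ++ (u1.leaves ++ (v.leaves ++ (u2.leaves ++ r.leaves)))).Nodup := by
    have := nodup_swap (p := lvs p ++ u1.leaves) (u := u2.leaves) (v := v.leaves)
      (r := r.leaves) (by simpa using hn)
    simpa using this
  have e3 := h1 p (.node u2 r) (by simpa [CTree.leaves] using hn')
  have e4 := R.phi_a (p ++ [v]) u1 u2 r
  simp only [spine_append, spine, List.length_append, List.length_cons, List.length_nil,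
    zero_add] at e2 e4
  have h := R.H1 p.length
  apply mul_left_cancel (a := a p.length)
  rw [← e1, e2, e3, e4, ← mul_assoc (a p.length), h]
  simp only [mul_assoc]

theorem sclaim (R : ACRels a c) (u v : CTree) : SClaim a c u v := by
  induction u with
  | leaf x =>
    apply R.sclaim_symm
    induction v with
    | leaf y => exact R.sclaim_leaf y x
    | node v1 v2 ih1 ih2 => exact R.sclaim_step ih1 ih2
  | node u1 u2 ih1 ih2 => exact R.sclaim_step ih1 ih2

/-- `C`-claim. -/
def CClaim (a c : ℕ → P) (u v : CTree) : Prop := ∀ (p : List CTree),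
  (lvs p ++ (u.leaves ++ v.leaves)).Nodup →
    Phi a c (spine p (.node u v)) = c p.length * Phi a c (spine p (.node v u))

theorem cclaim_symm (R : ACRels a c) {u v : CTree} (h : CClaim a c u v) : CClaim a c v u := by
  intro p hn
  rw [h p (by simpa using nodup_swap (r := []) (by simpa using hn)), ← mul_assoc, R.cc, one_mul]

theorem cclaim_leaf (R : ACRels a c) (x y : ℕ+) : CClaim a c (.leaf x) (.leaf y) := by
  intro p hn
  have hxy : x ≠ y := by
    rintro rfl
    rw [List.nodup_append] at hn
    simp [CTree.leaves] at hn
  have hsw := R.sortEl_swap hxy (lvs p) [] 0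
  rw [tau, if_pos (by rfl), zero_add] at hsw
  unfold Phi
  simp only [comb_spine, leaves_spine, CTree.leaves, comb, flat, List.cons_append,
    List.nil_append, one_mul]
  rw [← mul_assoc (c _), ← mul_assoc (c _), flats_shift0 R.shc, hsw]
  simp only [mul_assoc, one_mul]

theorem cclaim_step (R : ACRels a c) {u1 u2 v : CTree} (h2 : CClaim a c u2 v) :
    CClaim a c (.node u1 u2) v := by
  intro p hn
  simp only [CTree.leaves, List.append_assoc] at hn
  have e1 := R.phi_a p u1 u2 v
  have e2 := h2 (p ++ [u1]) (by simpa [lvs_append, lvs] using hn)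
  have hn' : (lvs p ++ (u1.leaves ++ (v.leaves ++ u2.leaves))).Nodup := by
    have := nodup_swap (p := lvs p ++ u1.leaves) (u := u2.leaves) (v := v.leaves)
      (r := []) (by simpa using hn)
    simpa using this
  have e3 := R.sclaim u1 v p u2 hn'
  simp only [spine_append, spine, List.length_append, List.length_cons, List.length_nil,
    zero_add] at e2
  have h := R.H2 p.length
  apply mul_left_cancel (a := a p.length)
  rw [← e1, e2, e3, ← mul_assoc, ← h, mul_assoc]

theorem cclaim (R : ACRels a c) (u v : CTree) : CClaim a c u v := by
  induction u with
  | leaf x =>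
    apply R.cclaim_symm
    induction v with
    | leaf y => exact R.cclaim_leaf y x
    | node v1 v2 ih1 ih2 => exact R.cclaim_step ih2
  | node u1 u2 ih1 ih2 => exact R.cclaim_step ih2

end ACRels
end TreePart

section MapPart

theorem pmul (f g : PMap) (t : CTree) : (f * g) t = (f t).bind g := rfl

theorem applyAt_mul (α : Addr) (f g : PMap) :
    applyAt α (f * g) = applyAt α f * applyAt α g := by
  induction α with
  | nil => rfl
  | cons b α ih =>
    funext t
    cases b <;> cases t with
    | leaf x => rfl
    | node u v =>
      simp only [applyAt, ih, pmul]
      cases applyAt α f u <;> cases applyAt α f v <;> simp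

theorem applyAt_append (α β : Addr) (f : PMap) :
    applyAt (α ++ β) f = applyAt α (applyAt β f) := by
  induction α with
  | nil => rfl
  | cons b α ih => cases b <;> simp [applyAt, ih]

theorem opa_add (n k : ℕ) : opa (n + k) = applyAt (List.replicate n true) (opa k) := by
  rw [opa, List.replicate_add, applyAt_append]; rfl

theorem opc_add (n k : ℕ) : opc (n + k) = applyAt (List.replicate n true) (opc k) := by
  rw [opc, List.replicate_add, applyAt_append]; rfl

theorem applyAt_spine (f : PMap) (n : ℕ) : ∀ t t',
    applyAt (List.replicate n true) f t = some t' →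
    ∃ p r r', p.length = n ∧ f r = some r' ∧ t = spine p r ∧ t' = spine p r' := by
  induction n with
  | zero => intro t t' h; exact ⟨[], t, t', rfl, h, rfl, rfl⟩
  | succ n ih =>
    intro t t' h
    cases t with
    | leaf x => simp [List.replicate_succ, applyAt] at h
    | node u v =>
      simp only [List.replicate_succ, applyAt, Option.map_eq_some_iff] at h
      obtain ⟨s, hs, rfl⟩ := h
      obtain ⟨p, r, r', hp, hr, rfl, rfl⟩ := ih _ _ hs
      exact ⟨u :: p, r, r', by simp [hp], hr, rfl, rfl⟩

/-- Operators near-equal to the identity. -/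
theorem nearEq_applyAt {f : PMap} (h : NearEq f 1) (α : Addr) : NearEq (applyAt α f) 1 := by
  induction α with
  | nil => exact h
  | cons b α ih =>
    obtain ⟨⟨t, ht, -⟩, h2⟩ := ih
    refine ⟨⟨.node t t, ?_, rfl⟩, ?_⟩
    · cases b <;> simpa [applyAt] using ht
    · intro u hu _
      show _ = some u
      cases u with
      | leaf x => cases b <;> simp [applyAt] at hu
      | node u v =>
        cases b
        · have hu' : (applyAt α f u).isSome := by simpa [applyAt] using hu
          have := h2 u hu' rfl
          simp only [applyAt, this]; rfl
        · have hu' : (applyAt α f v).isSome := by simpa [applyAt] using hu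
          have := h2 v hu' rfl
          simp only [applyAt, this]; rfl

theorem near_AAi : NearEq (opA * opAi) 1 := by
  refine ⟨⟨.node (.leaf 1) (.node (.leaf 1) (.leaf 1)), rfl, rfl⟩, ?_⟩
  intro t h _
  rcases t with x | ⟨u, y | ⟨v, w⟩⟩
  · simp [pmul, opA] at h
  · simp [pmul, opA] at h
  · rfl

theorem near_CC : NearEq (opC * opC) 1 := by
  refine ⟨⟨.node (.leaf 1) (.leaf 1), rfl, rfl⟩, ?_⟩
  intro t h _
  rcases t with x | ⟨u, v⟩
  · simp [pmul, opC] at h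
  · rfl

theorem e_sh (F : PMap) : opA * applyAt [true] F = applyAt [true, true] F * opA := by
  funext t
  rcases t with x | ⟨u, y | ⟨v, w⟩⟩
  · rfl
  · rfl
  · simp only [pmul, opA, applyAt]
    cases h : F w <;> simp [opA, h]

theorem e_S : opC * opAi * opc 1 = opS := by
  funext t
  rcases t with x | ⟨u, y | ⟨v, w⟩⟩ <;> rfl

theorem e_sc (F : PMap) : opS * applyAt [true, true] F = applyAt [true, true] F * opS := by
  funext t
  rcases t with x | ⟨u, y | ⟨v, w⟩⟩
  · rfl
  · rfl
  · simp only [pmul, opS, applyAt]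
    cases h : F w <;> simp [opS, h]

theorem e_r3 : opa 1 * opA * opC * opa 1 = opA * opA * opC := by
  funext t
  rcases t with x | ⟨u, y | ⟨v, z | ⟨w, r⟩⟩⟩ <;> rfl

theorem e_r4 : opA * opC * opc 1 * opA = opc 1 * opC := by
  funext t
  rcases t with x | ⟨u, y | ⟨v, w⟩⟩ <;> rfl

theorem e_r5 : opc 1 * opC * opAi * opc 1 = opC * opAi * opC * opAi := by
  funext t
  rcases t with x | ⟨u, y | ⟨v, w⟩⟩ <;> rfl

theorem e_conj (α : Addr) (f : PMap) :
    opC * applyAt (true :: α) f * opC = applyAt (false :: α) f := by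
  funext t
  rcases t with x | ⟨u, v⟩
  · rfl
  · simp only [pmul, opC, applyAt, Option.bind_some]
    cases h : applyAt α f u <;> simp [opC]

/-- Recolouring. -/
def CTree.recolour (h : ℕ+ → ℕ+) : CTree → CTree
  | .leaf x => .leaf (h x)
  | .node u v => .node (u.recolour h) (v.recolour h)

def Equi (f : PMap) : Prop := ∀ h t, f (CTree.recolour h t) = (f t).map (CTree.recolour h)

theorem equi_applyAt {f : PMap} (hf : Equi f) (α : Addr) : Equi (applyAt α f) := by
  induction α with
  | nil => exact hf
  | cons b α ih =>
    intro h t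
    cases b <;> cases t with
    | leaf x => rfl
    | node u v =>
      simp only [applyAt, CTree.recolour, ih h, Option.map_map]
      rfl

theorem equi_geo {f : PMap} (hf : f ∈ GeoAC) : Equi f := by
  refine Submonoid.closure_induction ?_ ?_ ?_ hf
  · rintro f ⟨α, rfl | rfl | rfl⟩
    · refine equi_applyAt ?_ α
      intro h t
      rcases t with x | ⟨u, y | ⟨v, w⟩⟩ <;> rfl
    · refine equi_applyAt ?_ α
      intro h t
      rcases t with x | ⟨y | ⟨u, v⟩, w⟩ <;> rfl
    · refine equi_applyAt ?_ α
      intro h t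
      rcases t with x | ⟨u, v⟩ <;> rfl
  · intro h t; rfl
  · intro f g _ _ hf hg h t
    simp only [pmul, hf h t]
    cases f t with
    | none => rfl
    | some s => exact hg h s

/-- A tree of the same shape with consecutive labels. -/
def CTree.enum : CTree → ℕ → CTree
  | .leaf _, n => .leaf n.succPNat
  | .node u v, n => .node (u.enum n) (v.enum (n + u.size))

theorem leaves_enum (t : CTree) : ∀ n,
    (t.enum n).leaves = (List.range' n t.size).map Nat.succPNat := by
  induction t with
  | leaf x => intro n; simp [CTree.enum, CTree.leaves, CTree.size]
  | node u v ihu ihv =>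
    intro n
    rw [CTree.enum, CTree.leaves, ihu, ihv, size_node, ← List.map_append, List.range'_append_1]

theorem nodup_enum (t : CTree) (n : ℕ) : (t.enum n).leaves.Nodup := by
  rw [leaves_enum]
  exact List.Nodup.map Nat.succPNat_injective List.nodup_range'

theorem recolour_enum (t : CTree) : ∀ n,
    (t.enum n).recolour (fun _ => 1) = t.recolour (fun _ => 1) := by
  induction t with
  | leaf x => intro n; rfl
  | node u v ihu ihv => intro n; simp [CTree.enum, CTree.recolour, ihu, ihv]

theorem exists_nodup {f : PMap} (hf : f ∈ GeoAC) {t : CTree} (ht : (f t).isSome) :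
    ∃ u : CTree, u.leaves.Nodup ∧ (f u).isSome := by
  refine ⟨t.enum 0, nodup_enum t 0, ?_⟩
  have h1 := equi_geo hf (fun _ => 1) t
  have h2 := equi_geo hf (fun _ => 1) (t.enum 0)
  rw [recolour_enum, h1] at h2
  have := congrArg Option.isSome h2
  simpa [ht] using this.symm

end MapPart

section Final

theorem fs_eq {H : Type*} [Group H] (f : Gen2 → H) (hc : ∀ n, f (.c n) * f (.c n) = 1) (n : ℕ) :
    FreeGroup.lift f (fs n) = sEl (fun n => f (.a n)) (fun n => f (.c n)) n := by
  simp [fs, fa, fc, sEl, inv_eq_of_mul_eq_one_left (hc (n + 1))]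

theorem lift_rels {H : Type*} [Group H] (f : Gen2 → H)
    (R : ACRels (fun n => f (.a n)) (fun n => f (.c n))) :
    ∀ r ∈ relsac, FreeGroup.lift f r = 1 := by
  have hs := fs_eq f R.cc
  have hci : ∀ n, (f (.c n))⁻¹ = f (.c n) := fun n => inv_eq_of_mul_eq_one_left (R.cc n)
  rintro r (⟨b, n, k, rfl⟩ | ⟨b, n, k, rfl⟩ | ⟨n, rfl⟩ | ⟨n, rfl⟩ | ⟨n, rfl⟩ | ⟨n, rfl⟩ | ⟨n, rfl⟩)
  · rw [map_mul, map_inv, mul_inv_eq_one]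
    cases b
    · simpa [fx, fa] using R.sha n k
    · simpa [fx, fa, fc] using R.shc n k
  · rw [map_mul, map_inv, mul_inv_eq_one, map_mul, map_mul, hs]
    cases b
    · simpa [fx, fa] using R.sca n k
    · simpa [fx, fc] using R.scc n k
  · rw [map_mul, map_inv, mul_inv_eq_one]
    simpa [fa, fc] using R.r3 n
  · rw [map_mul, map_inv, mul_inv_eq_one]
    simpa [fa, fc, hci] using R.r3 n
  · rw [map_mul, map_inv, mul_inv_eq_one]
    simpa [fa, fc] using R.r4 n
  · rw [map_mul, map_inv, mul_inv_eq_one]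
    simpa [fa, fc] using R.r5 n
  · simpa [fc] using R.cc n

theorem rels_of_lift {H : Type*} [Group H] (f : Gen2 → H)
    (h : ∀ r ∈ relsac, FreeGroup.lift f r = 1) :
    ACRels (fun n => f (.a n)) (fun n => f (.c n)) := by
  have cc : ∀ n, f (.c n) * f (.c n) = 1 := fun n => by
    simpa [fc] using h (fc n * fc n) (by simp only [relsac, Set.mem_ofPred_eq]; tauto)
  have hs := fs_eq f cc
  have key : ∀ x y, x * y⁻¹ ∈ relsac → FreeGroup.lift f x = FreeGroup.lift f y := fun x y hxy => by
    have := h _ hxy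
    rwa [map_mul, map_inv, mul_inv_eq_one] at this
  refine ⟨fun n k => ?_, fun n k => ?_, fun n k => ?_, fun n k => ?_, fun n => ?_, fun n => ?_,
    fun n => ?_, cc⟩
  · simpa [fx, fa] using key _ _ (Or.inl ⟨false, n, k, rfl⟩)
  · simpa [fx, fa, fc] using key _ _ (Or.inl ⟨true, n, k, rfl⟩)
  · have := key _ _ (Or.inr (Or.inl ⟨false, n, k, rfl⟩))
    rw [map_mul, map_mul, hs] at this
    simpa [fx, fa] using this
  · have := key _ _ (Or.inr (Or.inl ⟨true, n, k, rfl⟩))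
    rw [map_mul, map_mul, hs] at this
    simpa [fx, fc] using this
  · simpa [fa, fc] using key _ _ (Or.inr (Or.inr (Or.inl ⟨n, rfl⟩)))
  · simpa [fa, fc] using key _ _ (Or.inr (Or.inr (Or.inr (Or.inr (Or.inl ⟨n, rfl⟩)))))
  · simpa [fa, fc] using key _ _ (Or.inr (Or.inr (Or.inr (Or.inr (Or.inr (Or.inl ⟨n, rfl⟩))))))

theorem presented_rels : ACRels (fun n => (PresentedGroup.of (Gen2.a n) : PresentedGroup relsac))
    (fun n => PresentedGroup.of (Gen2.c n)) := by
  apply rels_of_lift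
  intro r hr
  have : FreeGroup.lift (PresentedGroup.of (rels := relsac)) = PresentedGroup.mk relsac := by
    ext x; simp [PresentedGroup.of]
  rw [this]
  exact PresentedGroup.one_of_mem hr

/-- The inverse of `opa n`. -/
def opai (n : ℕ) : PMap := applyAt (List.replicate n true) opAi

theorem memai (n : ℕ) : opai n ∈ GeoAC :=
  Submonoid.subset_closure ⟨List.replicate n true, Or.inr (Or.inl rfl)⟩

/-- `w` is a partial map tracking the abstract element `x`. -/
def Tracks {P : Type*} [Group P] (a c : ℕ → P) (x : P) (w : PMap) : Prop :=
  ∀ t t' : CTree, t.leaves.Nodup → w t = some t' →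
    t'.leaves.Nodup ∧ Phi a c t = x * Phi a c t'

theorem tracks_a {P : Type*} [Group P] {a c : ℕ → P} (R : ACRels a c) (n : ℕ) :
    Tracks a c (a n) (opa n) := by
  intro t t' hn h
  obtain ⟨p, r, r', rfl, hr, rfl, rfl⟩ := applyAt_spine _ _ _ _ h
  rcases r with x | ⟨u, y | ⟨v, w⟩⟩
  · simp [opA] at hr
  · simp [opA] at hr
  · simp only [opA, Option.some.injEq] at hr
    subst hr
    exact ⟨by simpa [leaves_spine, CTree.leaves] using hn, R.phi_a p u v w⟩

theorem tracks_ai {P : Type*} [Group P] {a c : ℕ → P} (R : ACRels a c) (n : ℕ) :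
    Tracks a c (a n)⁻¹ (opai n) := by
  intro t t' hn h
  obtain ⟨p, r, r', rfl, hr, rfl, rfl⟩ := applyAt_spine _ _ _ _ h
  rcases r with x | ⟨y | ⟨u, v⟩, w⟩
  · simp [opAi] at hr
  · simp [opAi] at hr
  · simp only [opAi, Option.some.injEq] at hr
    subst hr
    exact ⟨by simpa [leaves_spine, CTree.leaves] using hn, by rw [R.phi_a p u v w]; simp⟩

theorem tracks_c {P : Type*} [Group P] {a c : ℕ → P} (R : ACRels a c) (n : ℕ) :
    Tracks a c (c n) (opc n) := by
  intro t t' hn h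
  obtain ⟨p, r, r', rfl, hr, rfl, rfl⟩ := applyAt_spine _ _ _ _ h
  rcases r with x | ⟨u, v⟩
  · simp [opC] at hr
  · simp only [opC, Option.some.injEq] at hr
    subst hr
    rw [leaves_spine, CTree.leaves] at hn
    refine ⟨?_, R.cclaim u v p hn⟩
    rw [leaves_spine, CTree.leaves]
    simpa using nodup_swap (r := []) (by simpa using hn)

end Final


/-- Proposition 3.20: the relations `R_ac` completed with the torsion relations
`c_i² = 1` make a presentation of the geometry group `G(A,C)` — i.e. of any group
`G` obtained from the geometry monoid `𝒢(A,C)` by identifying near-equal elements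
(such a `G` is isomorphic to Thompson's group `V`) — in terms of the generators
`a_i = A_{1^{i-1}}` and `c_i = C_{1^{i-1}}`. -/
theorem stmt15 (G : Type*) [Group G] (q : GeoAC →* G)
    (hsurj : Function.Surjective q)
    (hiff : ∀ f g : GeoAC, q f = q g ↔ NearEq f.1 g.1) :
    ∃ iso : PresentedGroup relsac ≃* G,
      ∀ n : ℕ,
        iso (PresentedGroup.of (Gen2.a n)) = q ⟨opa n, mema n⟩ ∧
        iso (PresentedGroup.of (Gen2.c n)) = q ⟨opc n, memc n⟩ := by
  classical
  have one_of_near : ∀ f : GeoAC, NearEq f.1 1 → q f = 1 := fun f hf => by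
    rw [← map_one q]; exact (hiff f 1).2 hf
  have hAi : ∀ n, q ⟨opai n, memai n⟩ = (q ⟨opa n, mema n⟩)⁻¹ := fun n => by
    apply eq_inv_of_mul_eq_one_right
    rw [← map_mul]
    apply one_of_near
    show NearEq (opa n * opai n) 1
    rw [opa, opai, ← applyAt_mul]
    exact nearEq_applyAt near_AAi _
  have hCC : ∀ n, q ⟨opc n, memc n⟩ * q ⟨opc n, memc n⟩ = 1 := fun n => by
    rw [← map_mul]
    apply one_of_near
    show NearEq (opc n * opc n) 1
    rw [opc, ← applyAt_mul]
    exact nearEq_applyAt near_CC _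
  have a0 : ∀ n, opa n = applyAt (List.replicate n true) opA := fun n => rfl
  have c0 : ∀ n, opc n = applyAt (List.replicate n true) opC := fun n => rfl
  have a2 : ∀ k, opa (2 + k) = applyAt [true, true] (opa k) := fun k => opa_add 2 k
  have a1 : ∀ k, opa (1 + k) = applyAt [true] (opa k) := fun k => opa_add 1 k
  have c2 : ∀ k, opc (2 + k) = applyAt [true, true] (opc k) := fun k => opc_add 2 k
  have c1 : ∀ k, opc (1 + k) = applyAt [true] (opc k) := fun k => opc_add 1 k
  let f : Gen2 → G := fun x => match x with
    | .a n => q ⟨opa n, mema n⟩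
    | .c n => q ⟨opc n, memc n⟩
  have RG : ACRels (fun n => f (.a n)) (fun n => f (.c n)) := by
    have hs : ∀ n, sEl (fun n => f (.a n)) (fun n => f (.c n)) n =
        q (⟨opc n, memc n⟩ * ⟨opai n, memai n⟩ * ⟨opc (n + 1), memc (n + 1)⟩) := fun n => by
      simp only [sEl, f, map_mul, hAi]
    have hS : ∀ n, opc n * opai n * opc (n + 1) = applyAt (List.replicate n true) opS := fun n => by
      rw [opc_add n 1, opai, c0 n, ← applyAt_mul, ← applyAt_mul, e_S]
    refine ⟨fun n k => ?_, fun n k => ?_, fun n k => ?_, fun n k => ?_, fun n => ?_, fun n => ?_,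
      fun n => ?_, hCC⟩
    · simp only [f, ← map_mul]
      apply congrArg q; apply Subtype.ext
      show opa n * opa (n + 1 + k) = opa (n + 2 + k) * opa n
      rw [add_assoc, add_assoc, opa_add n (1 + k), opa_add n (2 + k), a0 n, ← applyAt_mul,
        ← applyAt_mul, a1, a2, e_sh]
    · simp only [f, ← map_mul]
      apply congrArg q; apply Subtype.ext
      show opa n * opc (n + 1 + k) = opc (n + 2 + k) * opa n
      rw [add_assoc, add_assoc, opc_add n (1 + k), opc_add n (2 + k), a0 n, ← applyAt_mul,
        ← applyAt_mul, c1, c2, e_sh]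
    · rw [hs]
      simp only [f, ← map_mul]
      apply congrArg q; apply Subtype.ext
      show opc n * opai n * opc (n + 1) * opa (n + 2 + k) =
        opa (n + 2 + k) * (opc n * opai n * opc (n + 1))
      rw [hS, add_assoc, opa_add n (2 + k), ← applyAt_mul, ← applyAt_mul, a2, e_sc]
    · rw [hs]
      simp only [f, ← map_mul]
      apply congrArg q; apply Subtype.ext
      show opc n * opai n * opc (n + 1) * opc (n + 2 + k) =
        opc (n + 2 + k) * (opc n * opai n * opc (n + 1))
      rw [hS, add_assoc, opc_add n (2 + k), ← applyAt_mul, ← applyAt_mul, c2, e_sc]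
    · simp only [f, ← map_mul]
      apply congrArg q; apply Subtype.ext
      show opa (n + 1) * opa n * opc n * opa (n + 1) = opa n * opa n * opc n
      rw [opa_add n 1, a0 n, c0 n]
      simp only [← applyAt_mul, e_r3]
    · simp only [f, ← map_mul]
      apply congrArg q; apply Subtype.ext
      show opa n * opc n * opc (n + 1) * opa n = opc (n + 1) * opc n
      rw [opc_add n 1, a0 n, c0 n]
      simp only [← applyAt_mul, e_r4]
    · simp only [f, ← hAi, ← map_mul]
      apply congrArg q; apply Subtype.ext
      show opc (n + 1) * opc n * opai n * opc (n + 1) = opc n * opai n * opc n * opai n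
      rw [opc_add n 1, opai, c0 n]
      simp only [← applyAt_mul, e_r5]
  have hrel := lift_rels f RG
  let φ : PresentedGroup relsac →* G := PresentedGroup.toGroup hrel
  have φa : ∀ n, φ (PresentedGroup.of (Gen2.a n)) = q ⟨opa n, mema n⟩ := fun n =>
    PresentedGroup.toGroup.of hrel
  have φc : ∀ n, φ (PresentedGroup.of (Gen2.c n)) = q ⟨opc n, memc n⟩ := fun n =>
    PresentedGroup.toGroup.of hrel
  -- injectivity
  have RP := presented_rels
  have track : ∀ y : FreeGroup Gen2, ∃ w : GeoAC, q w = φ (PresentedGroup.mk relsac y) ∧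
      Tracks (fun n => (PresentedGroup.of (Gen2.a n) : PresentedGroup relsac))
        (fun n => PresentedGroup.of (Gen2.c n)) (PresentedGroup.mk relsac y) w.1 := by
    intro y
    induction y using FreeGroup.induction_on with
    | C1 =>
      refine ⟨1, by simp, ?_⟩
      intro t t' hn h
      obtain rfl : t = t' := Option.some.inj h
      exact ⟨hn, by simp⟩
    | of x =>
      cases x with
      | a n => exact ⟨⟨opa n, mema n⟩, (φa n).symm, tracks_a RP n⟩
      | c n => exact ⟨⟨opc n, memc n⟩, (φc n).symm, tracks_c RP n⟩
    | inv_of x _ =>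
      cases x with
      | a n =>
        refine ⟨⟨opai n, memai n⟩, ?_, ?_⟩
        · rw [hAi, map_inv, map_inv]; exact congrArg _ (φa n).symm
        · rw [map_inv]; exact tracks_ai RP n
      | c n =>
        have hci : (PresentedGroup.mk relsac (FreeGroup.of (Gen2.c n)))⁻¹ =
            PresentedGroup.mk relsac (FreeGroup.of (Gen2.c n)) :=
          inv_eq_of_mul_eq_one_left (RP.cc n)
        rw [map_inv, hci]
        exact ⟨⟨opc n, memc n⟩, (φc n).symm, tracks_c RP n⟩
    | mul x y hx hy =>
      obtain ⟨w1, h1, t1⟩ := hx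
      obtain ⟨w2, h2, t2⟩ := hy
      refine ⟨w1 * w2, by simp [h1, h2], ?_⟩
      intro t t' hn h
      have h' : (w1.1 t).bind w2.1 = some t' := h
      obtain ⟨s, hs1, hs2⟩ := Option.bind_eq_some_iff.1 h'
      obtain ⟨n1, e1⟩ := t1 _ _ hn hs1
      obtain ⟨n2, e2⟩ := t2 _ _ n1 hs2
      exact ⟨n2, by rw [e1, e2, map_mul, mul_assoc]⟩
  have hinj : Function.Injective φ := by
    rw [injective_iff_map_eq_one]
    intro x hx
    obtain ⟨y, rfl⟩ := PresentedGroup.mk_surjective relsac x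
    obtain ⟨w, hw, tw⟩ := track y
    rw [hx, ← map_one q] at hw
    obtain ⟨⟨t, ht, -⟩, hne⟩ := (hiff w 1).1 hw
    obtain ⟨u, hu, hwu⟩ := exists_nodup w.2 ht
    have e : w.1 u = some u := hne u hwu rfl
    obtain ⟨-, h⟩ := tw u u hu e
    exact (mul_eq_right.1 h.symm)
  -- surjectivity
  have conj_mem : ∀ F : PMap, (∀ α, applyAt α F ∈ GeoAC) →
      (∀ n h, q ⟨applyAt (List.replicate n true) F, h⟩ ∈ φ.range) →
      ∀ (β : Addr) (n : ℕ) h, q ⟨applyAt (List.replicate n true ++ β) F, h⟩ ∈ φ.range := by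
    intro F hF h1 β
    induction β with
    | nil => intro n; simpa using h1 n
    | cons b β ih =>
      have ih' : ∀ (n : ℕ) h,
          q ⟨applyAt (List.replicate n true ++ true :: β) F, h⟩ ∈ φ.range := by
        intro n
        have : List.replicate n true ++ true :: β = List.replicate (n + 1) true ++ β := by
          rw [List.replicate_succ', List.append_assoc]; rfl
        rw [this]
        exact ih (n + 1)
      cases b
      · intro n h
        have e : (⟨applyAt (List.replicate n true ++ false :: β) F, h⟩ : GeoAC) =
            ⟨opc n, memc n⟩ * ⟨applyAt (List.replicate n true ++ true :: β) F, hF _⟩ *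
              ⟨opc n, memc n⟩ := by
          apply Subtype.ext
          show applyAt (List.replicate n true ++ false :: β) F =
            opc n * applyAt (List.replicate n true ++ true :: β) F * opc n
          rw [applyAt_append, applyAt_append, c0, ← applyAt_mul, ← applyAt_mul, e_conj]
        rw [e, map_mul, map_mul]
        exact mul_mem (mul_mem ⟨_, φc n⟩ (ih' n _)) ⟨_, φc n⟩
      · exact ih'
  have hsur : Function.Surjective φ := by
    rw [← MonoidHom.range_eq_top, eq_top_iff]
    rintro g -
    obtain ⟨⟨w, hw⟩, rfl⟩ := hsurj g
    induction hw using Submonoid.closure_induction with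
    | mem w hw =>
      obtain ⟨α, rfl | rfl | rfl⟩ := hw
      · exact conj_mem opA (fun α => Submonoid.subset_closure ⟨α, Or.inl rfl⟩)
          (fun n _ => ⟨_, φa n⟩) α 0 _
      · refine conj_mem opAi (fun α => Submonoid.subset_closure ⟨α, Or.inr (Or.inl rfl)⟩)
          (fun n _ => ?_) α 0 _
        have := φ.range.inv_mem ⟨_, φa n⟩
        rw [← hAi] at this
        exact this
      · exact conj_mem opC (fun α => Submonoid.subset_closure ⟨α, Or.inr (Or.inr rfl)⟩)
          (fun n _ => ⟨_, φc n⟩) α 0 _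
    | one =>
      have : q ⟨1, one_mem GeoAC⟩ = 1 := map_one q
      exact this ▸ one_mem _
    | mul x y hx hy h1 h2 =>
      have : q ⟨x * y, mul_mem hx hy⟩ = q ⟨x, hx⟩ * q ⟨y, hy⟩ := map_mul q ⟨x, hx⟩ ⟨y, hy⟩
      exact this ▸ mul_mem h1 h2
  exact ⟨MulEquiv.ofBijective φ ⟨hinj, hsur⟩, fun n => ⟨φa n, φc n⟩⟩
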